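/- If the span of ξ is d (the largest integer d with ξ ∈ dℤ almost surely), then for n ≡ 1 (mod d), P(|𝒯| = n) = (1/n) P(S_n = n − 1), where S_n = ξ_1 + ⋯ + ξ_n is a sum of n independent copies of ξ, and P(|𝒯| = n) ∼ d/(σ √(2π) n^{3/2}) as n → ∞ along n ≡ 1 (mod d). -/

import Mathlib

open scoped ENNReal BigOperators
open Set Filter

/-- Plane (ordered rooted) trees. -/
inductive PlaneTree : Type
  | node : List PlaneTree → PlaneTree

namespace PlaneTree

/-- The list of subtrees hanging off the root. -/
def children : PlaneTree → List PlaneTree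
  | .node ts => ts

/-- The subtree rooted at a given position (sequence of child indices), if it exists. -/
def subtreeAt : PlaneTree → List ℕ → Option PlaneTree
  | t, [] => some t
  | .node ts, i :: q =>
    match ts[i]? with
    | some t' => subtreeAt t' q
    | none => none

/-- The vertex set of a tree, with vertices identified with their positions. -/
def vertexSet (t : PlaneTree) : Set (List ℕ) := {q | (subtreeAt t q).isSome}

/-- The number of vertices of a tree. -/
noncomputable def size (t : PlaneTree) : ℕ := (vertexSet t).ncard

/-- The number of children of the vertex at position `q`. -/
def childCount (t : PlaneTree) (q : List ℕ) : ℕ :=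
  ((subtreeAt t q).map fun t' => t'.children.length).getD 0

end PlaneTree

/-- Longest common prefix of two positions; this is the position of the last common
ancestor of the two vertices. -/
def lca : List ℕ → List ℕ → List ℕ
  | a :: as, b :: bs => if a = b then a :: lca as bs else []
  | _, _ => []

/-- The distance from `v` up to the last common ancestor of `v` and `w`. -/
def dUp (v w : List ℕ) : ℕ := v.length - (lca v w).length

/-- The graph distance between the vertices at positions `v` and `w`. -/
def treeDist (v w : List ℕ) : ℕ := dUp v w + dUp w v

/-- The Galton–Watson probability of a given finite tree: the product, over all vertices,
of the probability that the offspring distribution takes the value given by the number of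
children of the vertex. -/
noncomputable def gwProb (p : ℕ → ℝ≥0∞) (t : PlaneTree) : ℝ≥0∞ :=
  ∏ᶠ v ∈ PlaneTree.vertexSet t, p (PlaneTree.childCount t v)

/-- `P(|𝒯| = n)` for the Galton–Watson tree `𝒯`. -/
noncomputable def probSize (p : ℕ → ℝ≥0∞) (n : ℕ) : ℝ≥0∞ :=
  ∑' t : PlaneTree, if PlaneTree.size t = n then gwProb p t else 0

/-- `E f(T_n)` where `T_n` is the Galton–Watson tree conditioned to have `n` vertices. -/
noncomputable def condExp (p : ℕ → ℝ≥0∞) (n : ℕ) (f : PlaneTree → ℝ≥0∞) : ℝ≥0∞ :=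
  (∑' t : PlaneTree, if PlaneTree.size t = n then gwProb p t * f t else 0) / probSize p n

/-- The variance of the offspring distribution `p` (which has mean `1`). -/
noncomputable def xiVar (p : ℕ → ℝ≥0∞) : ℝ≥0∞ :=
  ∑' k : ℕ, p k * ENNReal.ofReal (((k : ℝ) - 1) ^ 2)

/-- `P_k(t)`: the number of unordered pairs of vertices of `t` at graph distance `k`. -/
noncomputable def pairCount (t : PlaneTree) (k : ℕ) : ℕ :=
  {s : Set (List ℕ) | ∃ v w, v ∈ PlaneTree.vertexSet t ∧ w ∈ PlaneTree.vertexSet t ∧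
    s = {v, w} ∧ treeDist v w = k}.ncard

/-- `P(S_n = m)` where `S_n = ξ_1 + ⋯ + ξ_n` is a sum of `n` independent copies of the
offspring variable `ξ`. -/
noncomputable def probSum (p : ℕ → ℝ≥0∞) (n m : ℕ) : ℝ≥0∞ :=
  ∑' f : Fin n → ℕ, if (∑ i, f i) = m then ∏ i, p (f i) else 0

namespace PlaneTree

theorem vertexSet_node (ts : List PlaneTree) :
    vertexSet (node ts) =
      insert [] (⋃ i : Fin ts.length, List.cons (i : ℕ) '' vertexSet ts[i]) := by
  ext q
  cases q with
  | nil => simp [vertexSet, subtreeAt]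
  | cons i q =>
    by_cases hi : i < ts.length
    · simp only [vertexSet, subtreeAt, mem_ofPred_eq, List.getElem?_eq_getElem hi, mem_insert_iff,
        reduceCtorEq, mem_iUnion, mem_image, List.cons.injEq, false_or]
      constructor
      · intro h
        exact ⟨⟨i, hi⟩, q, h, rfl, rfl⟩
      · rintro ⟨j, q', h, rfl, rfl⟩
        exact h
    · simp only [vertexSet, subtreeAt, mem_ofPred_eq, List.getElem?_eq_none (not_lt.mp hi),
        mem_insert_iff, reduceCtorEq, mem_iUnion, mem_image, List.cons.injEq, false_or]
      simp only [Option.isSome_none, Bool.false_eq_true, false_iff, not_exists, not_and]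
      rintro j q' - rfl
      exact absurd j.2 hi

theorem vertexSet_finite : ∀ t : PlaneTree, (vertexSet t).Finite
  | .node ts => by
    rw [vertexSet_node]
    exact (finite_iUnion fun i : Fin ts.length =>
      (vertexSet_finite ts[i]).image _).insert _
decreasing_by
  have h := List.sizeOf_lt_of_mem (List.getElem_mem i.2)
  rw [node.sizeOf_spec]
  exact h.trans (Nat.lt_add_of_pos_left Nat.one_pos)

@[to_additive]
theorem finprod_mem_vertexSet_node {M : Type*} [CommMonoid M] (ts : List PlaneTree)
    (f : List ℕ → M) :
    ∏ᶠ v ∈ vertexSet (node ts), f v =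
      f [] * ∏ i : Fin ts.length, ∏ᶠ v ∈ vertexSet ts[i], f (i :: v) := by
  have hfin (i : Fin ts.length) : (List.cons (i : ℕ) '' vertexSet ts[i]).Finite :=
    (vertexSet_finite _).image _
  rw [vertexSet_node, finprod_mem_insert _ (by simp) (finite_iUnion hfin),
    finprod_mem_iUnion _ hfin, finprod_eq_prod_of_fintype]
  · congr 1
    refine Finset.prod_congr rfl fun i _ => ?_
    rw [finprod_mem_image]
    intro a _ b _ h
    exact (List.cons.inj h).2
  · intro i j hij
    rw [Function.onFun, Set.disjoint_left]
    rintro _ ⟨a, -, rfl⟩ ⟨b, -, h⟩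
    exact hij (Fin.ext (List.cons.inj h).1.symm)

theorem size_eq_finsum (t : PlaneTree) : size t = ∑ᶠ _v ∈ vertexSet t, 1 := by
  rw [size, finsum_one]

theorem size_node (ts : List PlaneTree) : size (node ts) = 1 + (ts.map size).sum := by
  rw [size_eq_finsum, finsum_mem_vertexSet_node, ← Fin.sum_univ_fun_getElem]
  simp_rw [size_eq_finsum]
  rfl

theorem size_pos : ∀ t : PlaneTree, 0 < size t
  | .node ts => by rw [size_node]; omega

theorem length_le_sum_size (ts : List PlaneTree) : ts.length ≤ (ts.map size).sum := by
  simpa using List.length_le_sum_of_one_le (ts.map size) (by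
    simp only [List.mem_map, forall_exists_index, and_imp, forall_apply_eq_imp_iff₂]
    exact fun t _ => t.size_pos)

end PlaneTree

open PlaneTree

theorem gwProb_node (p : ℕ → ℝ≥0∞) (ts : List PlaneTree) :
    gwProb p (.node ts) = p ts.length * (ts.map (gwProb p)).prod := by
  rw [gwProb, finprod_mem_vertexSet_node, ← Fin.prod_univ_fun_getElem]
  congr 1
  refine Finset.prod_congr rfl fun i _ => finprod_congr fun v => ?_
  simp [childCount, subtreeAt]

/-- The probability that a forest of `k` independent Galton–Watson trees has `n` vertices. -/
noncomputable def forestProb (p : ℕ → ℝ≥0∞) (k n : ℕ) : ℝ≥0∞ :=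
  ∑' ts : List PlaneTree,
    if ts.length = k ∧ (ts.map size).sum = n then (ts.map (gwProb p)).prod else 0

theorem forestProb_one (p : ℕ → ℝ≥0∞) (n : ℕ) : forestProb p 1 n = probSize p n := by
  have hinj : Function.Injective fun t : PlaneTree => [t] := fun a b h => by simpa using h
  rw [forestProb, probSize, ← hinj.tsum_eq]
  · simp
  · intro ts h
    rw [Function.mem_support, ne_eq, ite_eq_right_iff, Classical.not_imp] at h
    obtain ⟨t, rfl⟩ := List.length_eq_one_iff.mp h.1.1
    exact ⟨t, rfl⟩

theorem forestProb_zero_left (p : ℕ → ℝ≥0∞) (n : ℕ) :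
    forestProb p 0 n = if n = 0 then 1 else 0 := by
  rw [forestProb, tsum_eq_single []]
  · simp [eq_comm]
  · intro ts h
    simp [h]

theorem forestProb_eq_zero (p : ℕ → ℝ≥0∞) {k n : ℕ} (h : n < k) : forestProb p k n = 0 := by
  rw [forestProb, ENNReal.tsum_eq_zero]
  intro ts
  rw [if_neg]
  rintro ⟨rfl, rfl⟩
  exact absurd (length_le_sum_size ts) (not_le.mpr h)

/-- Removing the root of the first tree of a forest of `k + 1` trees leaves a forest in which that
tree is replaced by the subtrees hanging off its root. -/
theorem forestProb_succ_succ (p : ℕ → ℝ≥0∞) (k n : ℕ) :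
    forestProb p (k + 1) (n + 1) = ∑' j, p j * forestProb p (k + j) n := by
  have hinj : Function.Injective fun x : List PlaneTree × List PlaneTree =>
      PlaneTree.node x.1 :: x.2 := by
    rintro ⟨a, b⟩ ⟨c, d⟩ h
    simpa using h
  have hinj' : Function.Injective fun x : List PlaneTree × List PlaneTree =>
      (x.1.length, x.1 ++ x.2) := by
    rintro ⟨a, b⟩ ⟨c, d⟩ h
    simp only [Prod.mk.injEq] at h ⊢
    exact List.append_inj h.2 h.1
  simp_rw [forestProb, ← ENNReal.tsum_mul_left]
  rw [← ENNReal.tsum_prod' (f := fun x : ℕ × List PlaneTree => p x.1 *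
    if x.2.length = k + x.1 ∧ (x.2.map size).sum = n then (x.2.map (gwProb p)).prod else 0),
    ← hinj.tsum_eq, ← hinj'.tsum_eq]
  · refine tsum_congr fun ⟨a, b⟩ => ?_
    have h1 : a.length + b.length = k + a.length ↔ b.length = k := by omega
    have h2 : 1 + (a.map size).sum + (b.map size).sum = n + 1 ↔
        (a.map size).sum + (b.map size).sum = n := by omega
    simp [size_node, gwProb_node, h1, h2, mul_assoc]
  · rintro ⟨j, ts⟩ h
    have hj : ts.length = k + j := by
      by_contra hne
      simp [hne] at h
    refine ⟨(ts.take j, ts.drop j), ?_⟩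
    simp [hj]
  · rintro ts h
    rw [Function.mem_support, ne_eq, ite_eq_right_iff, Classical.not_imp] at h
    obtain ⟨⟨us⟩, vs, rfl⟩ := List.exists_cons_of_length_eq_add_one h.1.1
    exact ⟨(us, vs), rfl⟩

theorem probSum_eq_coeff (p : ℕ → ℝ≥0∞) (n m : ℕ) :
    probSum p n m = PowerSeries.coeff m (PowerSeries.mk p ^ n) := by
  induction n generalizing m with
  | zero =>
    rw [probSum, tsum_eq_single default fun f hf => absurd (Subsingleton.elim _ _) hf]
    simp [PowerSeries.coeff_one, eq_comm]
  | succ n ih =>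
    rw [pow_succ', PowerSeries.coeff_mul, probSum,
      ← (Fin.consEquiv fun _ : Fin (n + 1) => ℕ).tsum_eq, ENNReal.tsum_prod',
      Finset.Nat.sum_antidiagonal_eq_sum_range_succ_mk, tsum_eq_sum (s := Finset.range (m + 1))]
    · refine Finset.sum_congr rfl fun j hj => ?_
      rw [← ih, probSum, PowerSeries.coeff_mk, ← ENNReal.tsum_mul_left]
      refine tsum_congr fun f => ?_
      have hj : j ≤ m := Nat.lt_succ_iff.mp (Finset.mem_range.mp hj)
      have h : j + ∑ i, f i = m ↔ ∑ i, f i = m - j := by omega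
      simp [Fin.consEquiv, Fin.sum_univ_succ, Fin.prod_univ_succ, h]
    · intro j hj
      rw [Finset.mem_range, not_lt] at hj
      rw [ENNReal.tsum_eq_zero]
      intro f
      rw [if_neg]
      simp only [Fin.consEquiv, Equiv.coe_fn_mk, Fin.sum_univ_succ, Fin.cons_zero, Fin.cons_succ]
      omega

/-- Coefficientwise form of `X * (f ^ (n + 1))' = (n + 1) * (X * f') * f ^ n`. -/
theorem PowerSeries.succ_mul_sum_antidiagonal_coeff_pow {R : Type*} [CommSemiring R]
    (f : PowerSeries R) (n m : ℕ) :
    (n + 1) * ∑ ij ∈ Finset.HasAntidiagonal.antidiagonal m,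
        ij.1 * (coeff ij.1 f * coeff ij.2 (f ^ n)) =
      m * coeff m (f ^ (n + 1)) := by
  cases m with
  | zero => simp
  | succ m =>
    have h := congrArg (coeff m) (derivative_pow f (n + 1))
    rw [coeff_derivative, Nat.add_sub_cancel, mul_assoc, mul_comm (f ^ n),
      ← map_natCast (C (R := R)), coeff_C_mul, coeff_mul] at h
    rw [Finset.Nat.sum_antidiagonal_succ, mul_comm ((m + 1 : ℕ) : R)]
    push_cast at h ⊢
    rw [h]
    simp only [zero_mul, zero_add, coeff_derivative]
    congr 1
    exact Finset.sum_congr rfl fun _ _ => by ring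

/-- Dwass's identity for a forest of `k` trees. -/
theorem natCast_mul_forestProb (p : ℕ → ℝ≥0∞) {n k m : ℕ} (h : k + m = n) :
    n * forestProb p k n = k * PowerSeries.coeff m (PowerSeries.mk p ^ n) := by
  induction n generalizing k m with
  | zero =>
    obtain rfl : k = 0 := by omega
    simp
  | succ n ih =>
    obtain _ | k := k
    · simp [forestProb_zero_left]
    have hkm : k + m = n := by omega
    obtain rfl | hn := Nat.eq_zero_or_pos n
    · obtain ⟨rfl, rfl⟩ : k = 0 ∧ m = 0 := by omega
      rw [forestProb_succ_succ, tsum_eq_single 0]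
      · simp [forestProb_zero_left]
      · intro j hj
        rw [forestProb_eq_zero p (by omega), mul_zero]
    rw [← ENNReal.mul_right_inj (a := n) (by simpa using hn.ne') (by simp), forestProb_succ_succ]
    have key : (n : ℝ≥0∞) * ∑' j, p j * forestProb p (k + j) n =
        k * PowerSeries.coeff m (PowerSeries.mk p ^ (n + 1)) +
          ∑ ij ∈ Finset.HasAntidiagonal.antidiagonal m, (ij.1 : ℝ≥0∞) *
            (PowerSeries.coeff ij.1 (PowerSeries.mk p) *
              PowerSeries.coeff ij.2 (PowerSeries.mk p ^ n)) := by
      rw [← ENNReal.tsum_mul_left, tsum_eq_sum (s := Finset.range (m + 1)), pow_succ',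
        PowerSeries.coeff_mul, Finset.mul_sum, ← Finset.sum_add_distrib,
        Finset.Nat.sum_antidiagonal_eq_sum_range_succ_mk]
      · refine Finset.sum_congr rfl fun j hj => ?_
        have hj : j ≤ m := Nat.lt_succ_iff.mp (Finset.mem_range.mp hj)
        rw [mul_left_comm, ih (k := k + j) (m := m - j) (by omega), PowerSeries.coeff_mk]
        push_cast
        ring
      · intro j hj
        rw [Finset.mem_range, not_lt] at hj
        rw [forestProb_eq_zero p (by omega), mul_zero, mul_zero]
    rw [mul_left_comm, key, mul_add, Nat.cast_succ,
      PowerSeries.succ_mul_sum_antidiagonal_coeff_pow, ← hkm]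
    push_cast
    ring

theorem probSize_eq_probSum_div (p : ℕ → ℝ≥0∞) {n : ℕ} (hn : 1 ≤ n) :
    probSize p n = probSum p n (n - 1) / n := by
  have h := natCast_mul_forestProb p (n := n) (k := 1) (m := n - 1) (by omega)
  rw [forestProb_one, Nat.cast_one, one_mul, ← probSum_eq_coeff] at h
  rw [← h, mul_comm, ENNReal.mul_div_cancel_right (by simpa using by omega) (by simp)]

section GeneratingFunction

open PowerSeries Complex MeasureTheory

theorem summable_norm_coeff_mul_pow {f : PowerSeries ℂ} (hf : Summable fun k => ‖coeff k f‖)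
    {z : ℂ} (hz : ‖z‖ = 1) : Summable fun k => ‖coeff k f * z ^ k‖ := by
  simpa [hz] using hf

/-- Evaluating a power of an absolutely summable power series at a point of the unit circle. -/
theorem hasSum_coeff_pow_mul_pow {f : PowerSeries ℂ} (hf : Summable fun k => ‖coeff k f‖) (n : ℕ) :
    (Summable fun k => ‖coeff k (f ^ n)‖) ∧ ∀ z : ℂ, ‖z‖ = 1 →
      HasSum (fun k => coeff k (f ^ n) * z ^ k) ((∑' k, coeff k f * z ^ k) ^ n) := by
  induction n with
  | zero =>
    refine ⟨summable_of_ne_finset_zero (s := {0}) fun k hk => ?_, fun z _ => ?_⟩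
    · simp [coeff_one, Finset.notMem_singleton.mp hk]
    · convert! hasSum_single (f := fun k => coeff k (f ^ 0) * z ^ k) 0 fun k hk => ?_
      · simp
      · simp [coeff_one, hk]
  | succ n ih =>
    have hs : Summable fun k => ‖coeff k (f ^ (n + 1))‖ := by
      have h := summable_norm_sum_mul_antidiagonal_of_summable_norm
        (f := fun k => coeff k f) (g := fun k => coeff k (f ^ n)) hf ih.1
      exact h.congr fun k => by rw [pow_succ', coeff_mul]
    refine ⟨hs, fun z hz => ?_⟩
    have hmul := tsum_mul_tsum_eq_tsum_sum_antidiagonal_of_summable_norm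
      (summable_norm_coeff_mul_pow hf hz) (summable_norm_coeff_mul_pow ih.1 hz)
    rw [(ih.2 z hz).tsum_eq, ← pow_succ'] at hmul
    rw [hmul]
    convert! (summable_norm_coeff_mul_pow hs hz).of_norm.hasSum using 1
    refine tsum_congr fun m => ?_
    rw [pow_succ' f, coeff_mul, Finset.sum_mul]
    refine Finset.sum_congr rfl fun ij hij => ?_
    rw [← Finset.HasAntidiagonal.mem_antidiagonal.mp hij, pow_add]
    ring

theorem dvd_of_coeff_pow_ne_zero {R : Type*} [CommSemiring R] {f : PowerSeries R} {d : ℕ}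
    (hd : ∀ k, coeff k f ≠ 0 → d ∣ k) (n : ℕ) {k : ℕ} (hk : coeff k (f ^ n) ≠ 0) : d ∣ k := by
  induction n generalizing k with
  | zero =>
    obtain rfl : k = 0 := by
      by_contra h
      simp [coeff_one, h] at hk
    exact dvd_zero d
  | succ n ih =>
    rw [pow_succ', coeff_mul] at hk
    obtain ⟨ij, hij, h⟩ := Finset.exists_ne_zero_of_sum_ne_zero hk
    rw [← Finset.HasAntidiagonal.mem_antidiagonal.mp hij]
    exact dvd_add (hd _ (left_ne_zero_of_mul h)) (ih (right_ne_zero_of_mul h))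

theorem integral_exp_intCast_mul_I {d : ℕ} (hd : 0 < d) {l : ℤ} (hl : (d : ℤ) ∣ l) :
    ∫ t in (-(Real.pi / d))..(Real.pi / d), exp (l * I * t) =
      if l = 0 then ((2 * Real.pi / d : ℝ) : ℂ) else 0 := by
  split_ifs with h
  · simp only [h, Int.cast_zero, zero_mul, exp_zero, intervalIntegral.integral_const, real_smul,
      mul_one]
    congr 1
    ring
  · obtain ⟨j, rfl⟩ := hl
    have hc : (((d * j : ℤ) : ℂ)) * I ≠ 0 := mul_ne_zero (by exact_mod_cast h) I_ne_zero
    have hd' : (d : ℂ) ≠ 0 := by exact_mod_cast hd.ne'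
    rw [integral_exp_mul_complex hc, div_eq_zero_iff]
    left
    rw [sub_eq_zero, exp_eq_exp_iff_exists_int]
    refine ⟨j, ?_⟩
    push_cast
    field_simp
    ring

/-- Fourier inversion for the coefficients of a power of a power series supported on `dℕ`. -/
theorem coeff_pow_mul_eq_integral {f : PowerSeries ℂ} (hf : Summable fun k => ‖coeff k f‖)
    {d : ℕ} (hd : 0 < d) (hfd : ∀ k, coeff k f ≠ 0 → d ∣ k) (n : ℕ) {m : ℕ} (hm : d ∣ m) :
    coeff m (f ^ n) * ((2 * Real.pi / d : ℝ) : ℂ) =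
      ∫ t in (-(Real.pi / d))..(Real.pi / d),
        (∑' k, coeff k f * exp (t * I) ^ k) ^ n * exp (-(m * t * I)) := by
  obtain ⟨hs, hsum⟩ := hasSum_coeff_pow_mul_pow hf n
  have key : HasSum
      (fun k => ∫ t in (-(Real.pi / d))..(Real.pi / d),
        coeff k (f ^ n) * exp (t * I) ^ k * exp (-(m * t * I)))
      (∫ t in (-(Real.pi / d))..(Real.pi / d),
        (∑' k, coeff k f * exp (t * I) ^ k) ^ n * exp (-(m * t * I))) := by
    refine intervalIntegral.hasSum_integral_of_dominated_convergence
      (fun k _ => ‖coeff k (f ^ n)‖) (fun k => ?_) (fun k => ?_) ?_ ?_ ?_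
    · exact Continuous.aestronglyMeasurable (by fun_prop)
    · refine Eventually.of_forall fun t _ => le_of_eq ?_
      have : -((m : ℂ) * t * I) = ((-(m * t) : ℝ) : ℂ) * I := by push_cast; ring
      rw [this, norm_mul, norm_mul, norm_pow, norm_exp_ofReal_mul_I, norm_exp_ofReal_mul_I,
        one_pow, mul_one, mul_one]
    · exact Eventually.of_forall fun _ _ => hs
    · exact intervalIntegrable_const
    · exact Eventually.of_forall fun t _ => (hsum _ (norm_exp_ofReal_mul_I t)).mul_right _
  have hterm (k : ℕ) : ∫ t in (-(Real.pi / d))..(Real.pi / d),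
      coeff k (f ^ n) * exp (t * I) ^ k * exp (-(m * t * I)) =
        if k = m then coeff m (f ^ n) * ((2 * Real.pi / d : ℝ) : ℂ) else 0 := by
    by_cases hk : coeff k (f ^ n) = 0
    · simp only [hk, zero_mul, intervalIntegral.integral_zero]
      split_ifs with h
      · rw [← h, hk, zero_mul]
      · rfl
    have hdvd : (d : ℤ) ∣ (k : ℤ) - m :=
      dvd_sub (Int.natCast_dvd_natCast.mpr (dvd_of_coeff_pow_ne_zero hfd n hk))
        (Int.natCast_dvd_natCast.mpr hm)
    have hexp (t : ℝ) : coeff k (f ^ n) * exp (t * I) ^ k * exp (-(m * t * I)) =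
        coeff k (f ^ n) * exp (((k - m : ℤ) : ℂ) * I * t) := by
      rw [← exp_nat_mul, mul_assoc, ← exp_add]
      push_cast
      ring_nf
    simp_rw [hexp]
    rw [intervalIntegral.integral_const_mul, integral_exp_intCast_mul_I hd hdvd]
    simp only [sub_eq_zero, Nat.cast_inj]
    split_ifs with h
    · rw [h]
    · rw [mul_zero]
  simp_rw [hterm] at key
  exact (hasSum_ite_eq m _).unique key

end GeneratingFunction

section LocalLimit

open Complex MeasureTheory ProbabilityTheory Topology

/-- If `∑ a k • z ^ k` attains its maximal modulus at a point `z` of the unit circle and `a 0 ≠ 0`,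
then `z ^ k = 1` on the support of `a`. -/
theorem pow_eq_one_of_norm_tsum_mul_pow_eq_one {a : ℕ → ℝ} (ha0 : ∀ k, 0 ≤ a k) (ha : HasSum a 1)
    (h0 : a 0 ≠ 0) {z : ℂ} (hz : ‖z‖ = 1) (h : ‖∑' k, (a k : ℂ) * z ^ k‖ = 1) {k : ℕ}
    (hk : a k ≠ 0) : z ^ k = 1 := by
  set S := ∑' k, (a k : ℂ) * z ^ k
  have hsum : HasSum (fun k => (a k : ℂ) * z ^ k) S := by
    refine Summable.hasSum (Summable.of_norm ?_)
    simpa [hz, abs_of_nonneg (ha0 _)] using ha.summable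
  have hSS : starRingEnd ℂ S * S = 1 := by
    rw [mul_comm, mul_conj, normSq_eq_norm_sq, h]
    simp
  have hre : HasSum (fun k => a k * (1 - (starRingEnd ℂ S * z ^ k).re)) 0 := by
    have := ha.sub (hasSum_re (hsum.mul_left (starRingEnd ℂ S)))
    rw [hSS, one_re, sub_self] at this
    convert! this using 2 with k
    rw [mul_left_comm, re_ofReal_mul]
    ring
  have hnorm (k : ℕ) : ‖starRingEnd ℂ S * z ^ k‖ = 1 := by
    rw [norm_mul, norm_pow, hz, norm_conj, h, one_pow, one_mul]
  have hterm := (hasSum_zero_iff_of_nonneg fun k => mul_nonneg (ha0 k)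
    (sub_nonneg.mpr ((re_le_norm _).trans_eq (hnorm k)))).mp hre
  have hone {k : ℕ} (hk : a k ≠ 0) : starRingEnd ℂ S * z ^ k = 1 := by
    have h1 : (starRingEnd ℂ S * z ^ k).re = 1 := by
      have := congrFun hterm k
      simp only [Pi.zero_apply, mul_eq_zero, hk, false_or] at this
      linarith
    have h2 := Complex.sq_norm (starRingEnd ℂ S * z ^ k)
    rw [hnorm, normSq_apply, h1] at h2
    refine Complex.ext h1 ?_
    have : (starRingEnd ℂ S * z ^ k).im * (starRingEnd ℂ S * z ^ k).im = 0 := by linarith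
    simpa using mul_self_eq_zero.mp this
  have hc := hone h0
  rw [pow_zero, mul_one] at hc
  simpa [hc] using hone hk

theorem norm_tsum_mul_exp_pow_lt_one {a : ℕ → ℝ} (ha0 : ∀ k, 0 ≤ a k) (ha : HasSum a 1)
    (h0 : a 0 ≠ 0) {d : ℕ} (hd : 1 ≤ d) (hdvd : ∀ k, a k ≠ 0 → d ∣ k)
    (hmax : ∀ e : ℕ, (∀ k, a k ≠ 0 → e ∣ k) → e ≤ d) {t : ℝ} (ht0 : t ≠ 0)
    (ht : |t| ≤ Real.pi / d) : ‖∑' k, (a k : ℂ) * exp (t * I) ^ k‖ < 1 := by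
  have hz : ‖exp (t * I)‖ = 1 := norm_exp_ofReal_mul_I t
  refine lt_of_le_of_ne ?_ fun h => ht0 ?_
  · have hn : HasSum (fun k => ‖(a k : ℂ) * exp (t * I) ^ k‖) 1 := by
      simpa [hz, abs_of_nonneg (ha0 _)] using ha
    exact tsum_of_norm_bounded hn fun _ => le_rfl
  · have hord : ∀ k, a k ≠ 0 → orderOf (exp (t * I)) ∣ k := fun k hk =>
      orderOf_dvd_of_pow_eq_one (pow_eq_one_of_norm_tsum_mul_pow_eq_one ha0 ha h0 hz h hk)
    have hle := hmax _ fun k hk => Nat.lcm_dvd (hord k hk) (hdvd k hk)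
    have hpos : 0 < Nat.lcm (orderOf (exp (t * I))) d := by
      rw [Nat.pos_iff_ne_zero]
      intro h00
      have := hmax (d + 1) fun k hk => by
        have := Nat.lcm_dvd (hord k hk) (hdvd k hk)
        rw [h00, zero_dvd_iff] at this
        exact this ▸ dvd_zero _
      omega
    have hdiv : orderOf (exp (t * I)) ∣ d := by
      have := hle.antisymm (Nat.le_of_dvd hpos (Nat.dvd_lcm_right _ _))
      exact this ▸ Nat.dvd_lcm_left _ _
    have hone := orderOf_dvd_iff_pow_eq_one.mp hdiv
    rw [← exp_nat_mul, exp_eq_one_iff] at hone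
    obtain ⟨l, hl⟩ := hone
    have hl' : (d : ℝ) * t = l * (2 * Real.pi) := by
      have : ((d * t : ℝ) : ℂ) * I = ((l * (2 * Real.pi) : ℝ) : ℂ) * I := by
        push_cast
        rw [mul_assoc, hl]
        ring
      exact_mod_cast mul_right_cancel₀ I_ne_zero this
    have hd0 : (0 : ℝ) < d := by exact_mod_cast hd
    have habs : |(l : ℝ)| * (2 * Real.pi) ≤ Real.pi := by
      rw [← abs_of_pos Real.two_pi_pos, ← abs_mul, ← hl', abs_mul, abs_of_pos hd0, mul_comm]
      exact (le_div_iff₀ hd0).mp ht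
    have hl0 : l = 0 := by
      by_contra hne
      have h1 : (1 : ℝ) ≤ |(l : ℝ)| := by exact_mod_cast Int.one_le_abs hne
      nlinarith [Real.pi_pos]
    rw [hl0, Int.cast_zero, zero_mul, mul_eq_zero] at hl'
    exact hl'.resolve_left hd0.ne'

/-- A function with modulus less than `1` away from the origin and with the second order Taylor
expansion of a standardised characteristic function has a Gaussian upper bound. -/
theorem exists_norm_le_exp_neg_mul_sq {ψ : ℝ → ℂ} (hψ : Continuous ψ) {M : ℝ}
    (hlt : ∀ t, t ≠ 0 → |t| ≤ M → ‖ψ t‖ < 1)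
    (htaylor : (fun t : ℝ => ψ t - (1 - (t : ℂ) ^ 2 / 2)) =o[𝓝 0] fun t => t ^ 2) :
    ∃ c > 0, ∀ t, |t| ≤ M → ‖ψ t‖ ≤ Real.exp (-c * t ^ 2) := by
  have hnear : ∀ᶠ t in 𝓝 (0 : ℝ), ‖ψ t‖ ≤ Real.exp (-(1 / 4) * t ^ 2) := by
    have hsmall : ∀ᶠ t in 𝓝 (0 : ℝ), |t| < 1 :=
      (continuous_abs.tendsto' 0 0 abs_zero).eventually_lt_const one_pos
    filter_upwards [htaylor.bound (show (0 : ℝ) < 1 / 4 by norm_num), hsmall] with t ht ht1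
    have h1 : ‖(1 - (t : ℂ) ^ 2 / 2)‖ = 1 - t ^ 2 / 2 := by
      rw [show (1 - (t : ℂ) ^ 2 / 2) = ((1 - t ^ 2 / 2 : ℝ) : ℂ) by push_cast; ring, norm_real,
        Real.norm_of_nonneg]
      nlinarith [abs_lt.mp ht1]
    have h2 := norm_le_norm_add_norm_sub' (ψ t) (1 - (t : ℂ) ^ 2 / 2)
    rw [Real.norm_of_nonneg (sq_nonneg t)] at ht
    have h3 := Real.add_one_le_exp (-(1 / 4) * t ^ 2)
    linarith
  obtain ⟨δ, hδ, hball⟩ := Metric.eventually_nhds_iff.mp hnear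
  set K : Set ℝ := {t | δ ≤ |t| ∧ |t| ≤ M}
  have hKc : IsCompact K := by
    refine Metric.isCompact_of_isClosed_isBounded ?_ ?_
    · exact (isClosed_le continuous_const continuous_abs).inter
        (isClosed_le continuous_abs continuous_const)
    · refine (Metric.isBounded_closedBall (x := (0 : ℝ)) (r := M)).subset fun t ht => ?_
      simpa using ht.2
  obtain ⟨ρ, hρ0, hρ1, hρ⟩ : ∃ ρ : ℝ, 0 < ρ ∧ ρ < 1 ∧ ∀ t ∈ K, ‖ψ t‖ ≤ ρ := by
    rcases K.eq_empty_or_nonempty with hKe | hKn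
    · exact ⟨1 / 2, by norm_num, by norm_num, by simp [hKe]⟩
    · obtain ⟨t₀, ht₀, hmax⟩ := hKc.exists_isMaxOn hKn hψ.norm.continuousOn
      have h1 : ‖ψ t₀‖ < 1 := hlt t₀ (abs_pos.mp (hδ.trans_le ht₀.1)) ht₀.2
      exact ⟨max (1 / 2) ‖ψ t₀‖, by positivity, max_lt (by norm_num) h1,
        fun t ht => (hmax ht).trans (le_max_right _ _)⟩
  have hlog : 0 < -Real.log ρ := neg_pos.mpr (Real.log_neg hρ0 hρ1)
  refine ⟨min (1 / 4) (-Real.log ρ / (M ^ 2 + 1)), by positivity, fun t ht => ?_⟩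
  by_cases htδ : |t| < δ
  · refine (hball (by simpa using htδ)).trans (Real.exp_le_exp.mpr ?_)
    nlinarith [min_le_left (1 / 4) (-Real.log ρ / (M ^ 2 + 1)), sq_nonneg t]
  · refine (hρ t ⟨not_lt.mp htδ, ht⟩).trans ?_
    rw [← Real.exp_log hρ0, Real.exp_le_exp, Real.exp_log hρ0]
    have h1 : t ^ 2 ≤ M ^ 2 + 1 := by
      nlinarith [sq_abs t, abs_nonneg t, pow_le_pow_left₀ (abs_nonneg t) ht 2]
    have h2 := min_le_right (1 / 4) (-Real.log ρ / (M ^ 2 + 1))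
    have h3 : -Real.log ρ / (M ^ 2 + 1) * t ^ 2 ≤ -Real.log ρ := by
      rw [div_mul_eq_mul_div, div_le_iff₀ (by positivity)]
      exact mul_le_mul_of_nonneg_left h1 hlog.le
    nlinarith [sq_nonneg t]

/-- Laplace's method for powers of a characteristic function. -/
theorem tendsto_sqrt_mul_integral_pow {ψ : ℝ → ℂ} (hψ : Continuous ψ) {c M : ℝ} (hc : 0 < c)
    (hM : 0 < M) (hbound : ∀ t, |t| ≤ M → ‖ψ t‖ ≤ Real.exp (-c * t ^ 2))
    (hlim : ∀ t : ℝ, Tendsto (fun n : ℕ => ψ ((√n)⁻¹ * t) ^ n) atTop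
      (𝓝 (exp (-(t : ℂ) ^ 2 / 2)))) (s : ℝ) :
    Tendsto (fun n : ℕ => (√n : ℂ) * ∫ t in (-M)..M, ψ t ^ n * exp (s * t * I)) atTop
      (𝓝 (√(2 * Real.pi) : ℂ)) := by
  have hgauss : ∫ t : ℝ, exp (-(t : ℂ) ^ 2 / 2) = (√(2 * Real.pi) : ℂ) := by
    have h1 (t : ℝ) : exp (-(t : ℂ) ^ 2 / 2) = ((Real.exp (-(1 / 2) * t ^ 2) : ℝ) : ℂ) := by
      push_cast
      ring_nf
    simp_rw [h1]
    rw [integral_complex_ofReal, integral_gaussian]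
    congr 2
    ring
  set F : ℕ → ℝ → ℂ := fun n => (Set.Ioc (-(√n * M)) (√n * M)).indicator fun u =>
    ψ ((√n)⁻¹ * u) ^ n * exp (s * ((√n)⁻¹ * u : ℝ) * I) with hF
  have heq : ∀ᶠ n : ℕ in atTop, ∫ u, F n u =
      (√n : ℂ) * ∫ t in (-M)..M, ψ t ^ n * exp (s * t * I) := by
    filter_upwards [eventually_gt_atTop 0] with n hn
    have hn' : 0 < √(n : ℝ) := Real.sqrt_pos.mpr (by exact_mod_cast hn)
    have h := intervalIntegral.integral_comp_mul_left (a := -(√n * M)) (b := √n * M)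
      (fun t : ℝ => ψ t ^ n * exp (s * t * I)) (inv_ne_zero hn'.ne')
    rw [integral_indicator measurableSet_Ioc, ← intervalIntegral.integral_of_le, h, inv_inv,
      mul_neg, inv_mul_cancel_left₀ hn'.ne', real_smul]
    have := mul_pos hn' hM
    linarith
  refine Tendsto.congr' heq ?_
  rw [← hgauss]
  refine tendsto_integral_of_dominated_convergence (fun u => Real.exp (-c * u ^ 2)) (fun n => ?_)
    (integrable_exp_neg_mul_sq hc) (fun n => Eventually.of_forall fun u => ?_)
    (Eventually.of_forall fun u => ?_)
  · exact (Continuous.aestronglyMeasurable (by fun_prop)).indicator measurableSet_Ioc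
  · by_cases hu : u ∈ Set.Ioc (-(√n * M)) (√n * M)
    · have hn' : 0 < √(n : ℝ) := by
        have := hu.1.trans_le hu.2
        by_contra h0
        nlinarith [Real.sqrt_nonneg (n : ℝ)]
      have hu' : |(√n)⁻¹ * u| ≤ M := by
        rw [abs_mul, abs_of_pos (inv_pos.mpr hn'), inv_mul_le_iff₀ hn']
        exact abs_le.mpr ⟨hu.1.le, hu.2⟩
      rw [hF]
      simp only [Set.indicator_of_mem hu]
      rw [← ofReal_mul, norm_mul, norm_exp_ofReal_mul_I, mul_one, norm_pow]
      refine (pow_le_pow_left₀ (norm_nonneg _) (hbound _ hu') n).trans_eq ?_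
      rw [← Real.exp_nat_mul, mul_pow, inv_pow, Real.sq_sqrt (Nat.cast_nonneg n)]
      have : (n : ℝ) ≠ 0 := (Real.sqrt_pos.mp hn').ne'
      congr 1
      field_simp
    · rw [hF]
      simp only [Set.indicator_of_notMem hu, norm_zero]
      positivity
  · have hsqrt : Tendsto (fun n : ℕ => √(n : ℝ)) atTop atTop :=
      Real.tendsto_sqrt_atTop.comp tendsto_natCast_atTop_atTop
    have hmem : ∀ᶠ n : ℕ in atTop, |u| < √(n : ℝ) * M :=
      (hsqrt.atTop_mul_const hM).eventually_gt_atTop _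
    have hexp : Tendsto (fun n : ℕ => exp (s * ((√n)⁻¹ * u : ℝ) * I)) atTop (𝓝 1) := by
      have h0 : Tendsto (fun n : ℕ => (√(n : ℝ))⁻¹ * u) atTop (𝓝 0) := by
        simpa using hsqrt.inv_tendsto_atTop.mul_const u
      have hcont : Continuous fun x : ℝ => exp (s * x * I) := by fun_prop
      simpa [Function.comp_def] using (hcont.tendsto 0).comp h0
    have := (hlim u).mul hexp
    rw [mul_one] at this
    refine this.congr' ?_
    filter_upwards [hmem] with n hn
    rw [hF]
    simp only
    rw [Set.indicator_of_mem]
    exact ⟨(abs_lt.mp hn).1, (abs_lt.mp hn).2.le⟩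


/-- The measure on `ℕ` with mass `a k` at `k`. -/
noncomputable def weightMeasure (a : ℕ → ℝ) : Measure ℕ :=
  Measure.sum fun k => ENNReal.ofReal (a k) • Measure.dirac k

theorem integral_weightMeasure {E : Type*} [NormedAddCommGroup E] [NormedSpace ℝ E]
    [CompleteSpace E] {a : ℕ → ℝ} (ha0 : ∀ k, 0 ≤ a k) {f : ℕ → E}
    (hf : Summable fun k => a k * ‖f k‖) :
    ∫ k, f k ∂weightMeasure a = ∑' k, a k • f k := by
  have hint : Integrable f (weightMeasure a) :=
    integrable_sum_dirac (fun _ => ENNReal.ofReal_ne_top)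
      (by simpa [ENNReal.toReal_ofReal (ha0 _)] using hf)
  have h := hasSum_integral_measure hint
  rw [weightMeasure, ← h.tsum_eq]
  refine tsum_congr fun k => ?_
  rw [integral_smul_measure, integral_dirac, ENNReal.toReal_ofReal (ha0 k)]

theorem isProbabilityMeasure_weightMeasure {a : ℕ → ℝ} (ha0 : ∀ k, 0 ≤ a k) (ha : HasSum a 1) :
    IsProbabilityMeasure (weightMeasure a) := by
  refine ⟨?_⟩
  rw [weightMeasure, Measure.sum_apply _ MeasurableSet.univ]
  simp only [Measure.smul_apply, measure_univ, smul_eq_mul, mul_one]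
  rw [← ENNReal.ofReal_tsum_of_nonneg ha0 ha.summable, ha.tsum_eq, ENNReal.ofReal_one]

theorem charFun_map_weightMeasure {a : ℕ → ℝ} (ha0 : ∀ k, 0 ≤ a k) (ha : HasSum a 1) (σ t : ℝ) :
    charFun ((weightMeasure a).map fun k : ℕ => ((k : ℝ) - 1) / σ) t =
      exp (-((t / σ : ℝ) * I)) * ∑' k, (a k : ℂ) * exp ((t / σ : ℝ) * I) ^ k := by
  rw [charFun_apply_real, integral_map (by fun_prop) (by fun_prop), integral_weightMeasure ha0]
  · rw [← tsum_mul_left]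
    refine tsum_congr fun k => ?_
    rw [real_smul, mul_left_comm, ← exp_nat_mul, ← exp_add]
    push_cast
    ring_nf
  · have h (k : ℕ) : ‖exp (t * (((k : ℝ) - 1) / σ : ℝ) * I)‖ = 1 := by
      rw [← ofReal_mul, norm_exp_ofReal_mul_I]
    simpa only [h, mul_one] using ha.summable

/-- The local limit theorem for sums of `n` independent copies of a variable with mean `1`,
evaluated at `n - 1`. -/
theorem tendsto_sqrt_mul_coeff_pow {a : ℕ → ℝ} (ha0 : ∀ k, 0 ≤ a k) (ha : HasSum a 1)
    (hm : HasSum (fun k => a k * ((k : ℝ) - 1)) 0) {σ : ℝ} (hσ : 0 < σ)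
    (hv : HasSum (fun k => a k * ((k : ℝ) - 1) ^ 2) (σ ^ 2)) {d : ℕ} (hd : 1 ≤ d)
    (hdvd : ∀ k, a k ≠ 0 → d ∣ k) (hmax : ∀ e : ℕ, (∀ k, a k ≠ 0 → e ∣ k) → e ≤ d) :
    Tendsto (fun m : ℕ => (√((d * m + 1 : ℕ) : ℝ) : ℂ) * (σ * (2 * Real.pi / d : ℝ) *
      PowerSeries.coeff (d * m) (PowerSeries.mk (fun k => (a k : ℂ)) ^ (d * m + 1)))) atTop
      (𝓝 (√(2 * Real.pi) : ℂ)) := by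
  have hd0 : (0 : ℝ) < d := by exact_mod_cast hd
  have h0 : a 0 ≠ 0 := by
    intro h0
    have hnn (k : ℕ) : 0 ≤ a k * ((k : ℝ) - 1) := by
      obtain _ | k := k
      · simp [h0]
      · exact mul_nonneg (ha0 _) (by push_cast; linarith [(Nat.cast_nonneg k : (0 : ℝ) ≤ k)])
    have hz := (hasSum_zero_iff_of_nonneg hnn).mp hm
    have hzero : (fun k => a k * ((k : ℝ) - 1) ^ 2) = fun _ => 0 := by
      ext k
      rw [sq, ← mul_assoc, congrFun hz k, Pi.zero_apply, zero_mul]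
    rw [hzero] at hv
    exact (pow_pos hσ 2).ne (hasSum_zero.unique hv)
  have := isProbabilityMeasure_weightMeasure ha0 ha
  set X : ℕ → ℝ := fun k => ((k : ℝ) - 1) / σ with hX
  have hXm : AEMeasurable X (weightMeasure a) := by fun_prop
  have hmean : ∫ k, X k ∂weightMeasure a = 0 := by
    rw [integral_weightMeasure ha0]
    · simpa [hX, mul_div_assoc] using (hm.div_const σ).tsum_eq
    · simpa [hX, mul_div_assoc, abs_mul, abs_of_nonneg (ha0 _), abs_div] using
        (hm.summable.div_const σ).abs
  have hvar : ∫ k, (X ^ 2) k ∂weightMeasure a = 1 := by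
    have hs := hv.div_const (σ ^ 2)
    rw [div_self (pow_pos hσ 2).ne'] at hs
    simp only [mul_div_assoc, ← div_pow] at hs
    rw [integral_weightMeasure ha0]
    · simpa [hX] using hs.tsum_eq
    · simpa only [hX, Pi.pow_apply, norm_pow, Real.norm_eq_abs, sq_abs] using hs.summable
  set ψ : ℝ → ℂ := charFun ((weightMeasure a).map X)
  have hform (t : ℝ) : ψ t = exp (-((t / σ : ℝ) * I)) *
      ∑' k, (a k : ℂ) * exp ((t / σ : ℝ) * I) ^ k := charFun_map_weightMeasure ha0 ha σ t
  have : IsProbabilityMeasure ((weightMeasure a).map X) := Measure.isProbabilityMeasure_map hXm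
  have hψc : Continuous ψ := continuous_charFun
  have hM : 0 < σ * (Real.pi / d) := by positivity
  obtain ⟨c, hc, hbound⟩ := exists_norm_le_exp_neg_mul_sq hψc (M := σ * (Real.pi / d))
    (fun t ht0 ht => by
      rw [hform, norm_mul, ← neg_mul, ← ofReal_neg, norm_exp_ofReal_mul_I, one_mul]
      refine norm_tsum_mul_exp_pow_lt_one ha0 ha h0 hd hdvd hmax (div_ne_zero ht0 hσ.ne') ?_
      rwa [abs_div, abs_of_pos hσ, div_le_iff₀' hσ])
    (taylor_charFun_two hXm hmean hvar)
  have hlim := tendsto_sqrt_mul_integral_pow hψc hc hM hbound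
    (fun t => tendsto_charFun_inv_sqrt_mul_pow hXm hmean hvar t) σ⁻¹
  have hsub : Tendsto (fun m : ℕ => d * m + 1) atTop atTop :=
    tendsto_atTop_mono (fun m => (Nat.le_mul_of_pos_left m hd).trans (Nat.le_succ _)) tendsto_id
  refine (hlim.comp hsub).congr fun m => ?_
  rw [Function.comp_apply]
  congr 1
  have hsumm : Summable fun k => ‖PowerSeries.coeff k (PowerSeries.mk fun k => (a k : ℂ))‖ := by
    simpa [abs_of_nonneg (ha0 _)] using ha.summable
  have hfour := coeff_pow_mul_eq_integral hsumm hd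
    (fun k hk => hdvd k (by simpa using hk)) (d * m + 1) (Nat.dvd_mul_right d m)
  rw [mul_assoc, mul_comm ((2 * Real.pi / d : ℝ) : ℂ), hfour]
  have hcov := intervalIntegral.integral_comp_mul_left (a := -(Real.pi / d)) (b := Real.pi / d)
    (fun t : ℝ => ψ t ^ (d * m + 1) * exp ((σ⁻¹ : ℝ) * t * I)) hσ.ne'
  rw [real_smul, mul_neg] at hcov
  rw [← inv_mul_eq_iff_eq_mul₀ (by exact_mod_cast hσ.ne'), ← ofReal_inv, ← hcov]
  refine intervalIntegral.integral_congr fun t _ => ?_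
  simp only [hform, mul_div_cancel_left₀ t hσ.ne', PowerSeries.coeff_mk]
  rw [mul_pow, ← exp_nat_mul, mul_right_comm, ← exp_add, mul_comm]
  congr 2
  have hσ' : (σ : ℂ) ≠ 0 := by exact_mod_cast hσ.ne'
  push_cast
  field_simp
  ring

end LocalLimit

theorem toReal_probSum {p : ℕ → ℝ≥0∞} (hp : ∀ k, p k ≠ ⊤) (n m : ℕ) :
    (((probSum p n m).toReal : ℝ) : ℂ) =
      PowerSeries.coeff m (PowerSeries.mk (fun k => ((p k).toReal : ℂ)) ^ n) := by
  set f : PowerSeries NNReal := PowerSeries.mk fun k => (p k).toNNReal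
  have h1 : PowerSeries.mk p = f.map ENNReal.ofNNRealHom := by
    ext k
    simp [f, hp k]
  have h2 : PowerSeries.mk (fun k => ((p k).toReal : ℂ)) =
      f.map (Complex.ofRealHom.comp NNReal.toRealHom) := by
    ext k
    simp [f, ENNReal.coe_toNNReal_eq_toReal]
  rw [probSum_eq_coeff, h1, h2, ← map_pow, ← map_pow, PowerSeries.coeff_map,
    PowerSeries.coeff_map]
  simp

/-- Dwass's identity and the local limit asymptotics, Lemma 1 of
Devroye–Janson.  If `ξ` has span `d`, then `P(|𝒯| = n) = (1/n) P(S_n = n - 1)` for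
`n ≡ 1 (mod d)`, and `P(|𝒯| = n) ∼ d / (σ √(2π) n^{3/2})` as `n → ∞` with
`n ≡ 1 (mod d)`. -/
theorem probSize_eq_and_asymp
    (p : ℕ → ℝ≥0∞) (hp : ∑' k : ℕ, p k = 1)
    (hmean : ∑' k : ℕ, (k : ℝ≥0∞) * p k = 1)
    (hvar_pos : 0 < xiVar p) (hvar_fin : xiVar p ≠ ⊤)
    (d : ℕ) (hd : 1 ≤ d)
    (hspan_div : ∀ k : ℕ, p k ≠ 0 → d ∣ k)
    (hspan_max : ∀ e : ℕ, (∀ k : ℕ, p k ≠ 0 → e ∣ k) → e ≤ d) :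
    (∀ n : ℕ, 1 ≤ n → n % d = 1 % d →
        probSize p n = probSum p n (n - 1) / n) ∧
      Filter.Tendsto
        (fun m : ℕ => (probSize p (d * m + 1)).toReal *
          Real.sqrt ((xiVar p).toReal) * Real.sqrt (2 * Real.pi) *
          ((d * m + 1 : ℕ) : ℝ) ^ ((3 : ℝ) / 2) / d)
        Filter.atTop (nhds 1) := by
  refine ⟨fun n hn _ => probSize_eq_probSum_div p hn, ?_⟩
  have hpt (k : ℕ) : p k ≠ ⊤ := ENNReal.ne_top_of_tsum_ne_top (by simp [hp]) k
  set a : ℕ → ℝ := fun k => (p k).toReal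
  have ha0 (k : ℕ) : 0 ≤ a k := ENNReal.toReal_nonneg
  have ha_ne (k : ℕ) : a k ≠ 0 ↔ p k ≠ 0 := by simp [a, ENNReal.toReal_eq_zero_iff, hpt k]
  have ha : HasSum a 1 := by
    have h := ENNReal.hasSum_toReal (f := p) (by simp [hp])
    rwa [← ENNReal.tsum_toReal_eq hpt, hp, ENNReal.toReal_one] at h
  have hm : HasSum (fun k => a k * ((k : ℝ) - 1)) 0 := by
    have h := ENNReal.hasSum_toReal (f := fun k : ℕ => (k : ℝ≥0∞) * p k) (by simp [hmean])
    rw [← ENNReal.tsum_toReal_eq fun k => ENNReal.mul_ne_top (by simp) (hpt k), hmean] at h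
    convert! h.sub ha using 1
    · ext k
      simp only [ENNReal.toReal_mul, ENNReal.toReal_natCast, a]
      ring
    · simp
  set σ : ℝ := √(xiVar p).toReal
  have hσ : 0 < σ := Real.sqrt_pos.mpr (ENNReal.toReal_pos hvar_pos.ne' hvar_fin)
  have hv : HasSum (fun k => a k * ((k : ℝ) - 1) ^ 2) (σ ^ 2) := by
    have h := ENNReal.hasSum_toReal hvar_fin
    rw [Real.sq_sqrt ENNReal.toReal_nonneg]
    convert! h using 1
    · ext k
      simp [a, ENNReal.toReal_ofReal (sq_nonneg _)]
    · rw [xiVar, ENNReal.tsum_toReal_eq fun k => ENNReal.mul_ne_top (hpt k) (by simp)]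
  have hlim := tendsto_sqrt_mul_coeff_pow ha0 ha hm hσ hv hd
    (fun k hk => hspan_div k ((ha_ne k).mp hk))
    (fun e he => hspan_max e fun k hk => he k ((ha_ne k).mpr hk))
  simp only [a, ← toReal_probSum hpt] at hlim
  have hreal : Tendsto (fun m : ℕ => √((d * m + 1 : ℕ) : ℝ) * (σ * (2 * Real.pi / d) *
      (probSum p (d * m + 1) (d * m)).toReal)) atTop (nhds √(2 * Real.pi)) := by
    rw [← tendsto_ofReal_iff]
    exact_mod_cast hlim
  have hpi : √(2 * Real.pi) ≠ 0 := (Real.sqrt_pos.mpr Real.two_pi_pos).ne'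
  have hdiv := hreal.div_const √(2 * Real.pi)
  rw [div_self hpi] at hdiv
  refine hdiv.congr fun m => ?_
  rw [probSize_eq_probSum_div p (Nat.le_add_left 1 (d * m)), Nat.add_sub_cancel, ENNReal.toReal_div,
    ENNReal.toReal_natCast]
  have hn : (0 : ℝ) < ((d * m + 1 : ℕ) : ℝ) := by positivity
  have hpow : ((d * m + 1 : ℕ) : ℝ) ^ ((3 : ℝ) / 2) =
      ((d * m + 1 : ℕ) : ℝ) * √((d * m + 1 : ℕ) : ℝ) := by
    rw [Real.sqrt_eq_rpow, show (3 : ℝ) / 2 = 1 + 1 / 2 by norm_num, Real.rpow_add hn,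
      Real.rpow_one]
  have hsq : 2 * Real.pi = √(2 * Real.pi) * √(2 * Real.pi) :=
    (Real.mul_self_sqrt Real.two_pi_pos.le).symm
  have hd0 : (d : ℝ) ≠ 0 := by exact_mod_cast (Nat.one_le_iff_ne_zero.mp hd)
  rw [hpow]
  generalize √(2 * Real.pi) = q at hpi hsq ⊢
  rw [hsq]
  field_simp
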